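/- arXiv:2007.12893 — 2 statements merged into one kernel-verified Lean document; each statement's English description precedes it below -/
import Mathlib

section
/- Let P = conv{x_1,…,x_m} ⊂ ℝ^d be a full-dimensional compact convex polytope with a triangulation Σ using only the vertices of P, and let Ad_P be its adjoint polynomial. Then Ad_P is a polynomial of total degree at most m − d − 1, and Ad_P(t) = 0 for every t in the nonface subspace arrangement NF(P). -/
open MeasureTheory Finset

/-- A triangulation of the polytope `P = conv{x_1,…,x_m} ⊆ ℝ^d` using only the vertices
`x_1,…,x_m`. -/
structure Triangulation (d m : ℕ) (x : Fin m → (Fin d → ℝ)) where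
  simplices : Finset (Finset (Fin m))
  card_eq : ∀ σ ∈ simplices, σ.card = d + 1
  indep : ∀ σ ∈ simplices, AffineIndependent ℝ (fun k : {k // k ∈ σ} => x k.1)
  covers : (⋃ σ ∈ simplices, convexHull ℝ (x '' ↑σ)) = convexHull ℝ (Set.range x)
  disj : ∀ σ ∈ simplices, ∀ τ ∈ simplices, σ ≠ τ →
    interior (convexHull ℝ (x '' ↑σ)) ∩ interior (convexHull ℝ (x '' ↑τ)) = ∅

/-- The affine-linear polynomial `ℒ_k(t) = 1 − x_{k,1}t_1 − ⋯ − x_{k,d}t_d`. -/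
noncomputable def Lpoly (d m : ℕ) (x : Fin m → (Fin d → ℝ)) (k : Fin m) :
    MvPolynomial (Fin d) ℝ :=
  1 - ∑ j, MvPolynomial.C (x k j) * MvPolynomial.X j

/-- The adjoint polynomial `Ad_P(t) = ∑_{σ∈Σ} (V_d(σ)/V_d(P)) ∏_{k∉σ} ℒ_k(t)` of `P`,
computed from the triangulation `Σ`. -/
noncomputable def adjoint (d m : ℕ) (x : Fin m → (Fin d → ℝ)) (T : Triangulation d m x) :
    MvPolynomial (Fin d) ℝ :=
  ∑ σ ∈ T.simplices,
    MvPolynomial.C ((volume (convexHull ℝ (x '' ↑σ))).toReal /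
        (volume (convexHull ℝ (Set.range x))).toReal) *
      ∏ k ∈ σᶜ, Lpoly d m x k

/-- `τ ⊆ {1,…,m}` indexes the vertex set of a face of `P = conv{x_1,…,x_m}`:
there is an exposed face `G` of `P` whose vertex set (the vertices of `P` lying on `G`)
is exactly `{x_k : k ∈ τ}`. -/
def IsFaceVtxSet (d m : ℕ) (x : Fin m → (Fin d → ℝ)) (τ : Finset (Fin m)) : Prop :=
  ∃ G : Set (Fin d → ℝ), IsExposed ℝ (convexHull ℝ (Set.range x)) G ∧
    x '' ↑τ = G ∩ Set.range x

theorem setIntegral_Ici_exp_neg_mul {a : ℝ} (ha : 0 < a) :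
    ∫ u in Set.Ici (0 : ℝ), Real.exp (-(u * a)) = a⁻¹ := by
  rw [integral_Ici_eq_integral_Ioi]
  have h := integral_exp_mul_Ioi (a := -a) (by linarith) 0
  simp only [mul_zero, Real.exp_zero] at h
  rw [← neg_div_neg_eq, neg_neg, neg_neg, one_div] at h
  rw [← h]
  congr 1
  ext u
  ring_nf

theorem integrableOn_Ici_exp_neg_mul {a : ℝ} (ha : 0 < a) :
    IntegrableOn (fun u : ℝ => Real.exp (-(u * a))) (Set.Ici 0) := by
  rw [integrableOn_Ici_iff_integrableOn_Ioi]
  refine (integrableOn_exp_mul_Ioi (a := -a) (by linarith) 0).congr_fun (fun u _ => ?_)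
    measurableSet_Ioi
  simp only
  ring_nf

theorem restrict_pi_Ici (n : ℕ) :
    (volume : Measure (Fin n → ℝ)).restrict (Set.Ici 0) =
      Measure.pi fun _ : Fin n => (volume : Measure ℝ).restrict (Set.Ici 0) := by
  rw [← Measure.restrict_pi_pi, ← volume_pi, Set.pi_univ_Ici]
  rfl

/-- The exponential integral over a simplicial cone. -/
theorem integral_exp_simplicialCone {n : ℕ} (b : Fin n → Fin n → ℝ)
    (hb : Function.Injective (Fintype.linearCombination ℝ b)) (s : (Fin n → ℝ) →ₗ[ℝ] ℝ)
    (hs : ∀ i, 0 < s (b i)) :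
    IntegrableOn (fun p => Real.exp (-(s p)))
        (Fintype.linearCombination ℝ b '' Set.Ici 0) ∧
      ∫ p in Fintype.linearCombination ℝ b '' Set.Ici 0, Real.exp (-(s p)) =
        |LinearMap.det (Fintype.linearCombination ℝ b)| * ∏ i, (s (b i))⁻¹ := by
  set L := Fintype.linearCombination ℝ b with hL
  have hd : ∀ p ∈ Set.Ici (0 : Fin n → ℝ),
      HasFDerivWithinAt L (LinearMap.toContinuousLinearMap L) (Set.Ici 0) p := fun p _ =>
    (LinearMap.toContinuousLinearMap L).hasFDerivWithinAt
  have hexp : ∀ c : Fin n → ℝ,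
      Real.exp (-(s (L c))) = ∏ i, Real.exp (-(c i * s (b i))) := by
    intro c
    rw [← Real.exp_sum, hL, Fintype.linearCombination_apply, map_sum, ← Finset.sum_neg_distrib]
    simp
  constructor
  · rw [integrableOn_image_iff_integrableOn_abs_det_fderiv_smul volume measurableSet_Ici hd
      hb.injOn]
    simp_rw [hexp]
    rw [IntegrableOn, restrict_pi_Ici]
    exact (Integrable.fintype_prod (f := fun i u => Real.exp (-(u * s (b i))))
      fun i => integrableOn_Ici_exp_neg_mul (hs i)).const_mul _
  · rw [integral_image_eq_integral_abs_det_fderiv_smul volume measurableSet_Ici hd hb.injOn]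
    rw [integral_smul, smul_eq_mul]
    congr 1
    simp_rw [hexp]
    rw [restrict_pi_Ici,
      integral_fintype_prod_eq_prod (f := fun i u => Real.exp (-(u * s (b i))))]
    exact Finset.prod_congr rfl fun i _ => setIntegral_Ici_exp_neg_mul (hs i)

/-- The `d`-simplex spanned by the origin and the coordinate vectors. -/
def cornerSimplex (d : ℕ) : Set (Fin d → ℝ) :=
  convexHull ℝ (Set.range (Fin.cons 0 (fun i => Pi.single i 1) : Fin (d + 1) → Fin d → ℝ))

theorem det_linearCombination_cons_one {d : ℕ} (z : Fin (d + 1) → Fin d → ℝ) :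
    LinearMap.det (Fintype.linearCombination ℝ fun i => (Fin.cons 1 (z i) : Fin (d + 1) → ℝ)) =
      LinearMap.det (Fintype.linearCombination ℝ fun i : Fin d => z i.succ - z 0) := by
  have key : ∀ (n : ℕ) (b : Fin n → Fin n → ℝ),
      LinearMap.det (Fintype.linearCombination ℝ b) = (Matrix.of b).det := by
    intro n b
    rw [← Matrix.det_transpose, ← LinearMap.det_toLin']
    congr 1
    ext i j
    simp [Matrix.mulVec, dotProduct, Fintype.linearCombination_apply, Pi.single_apply, Finset.sum_apply, ite_apply]
  rw [key, key, Matrix.det_eq_of_forall_row_eq_smul_add_const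
    (B := Matrix.of (Fin.cons (Fin.cons 1 (z 0)) fun i : Fin d => Fin.cons 0 (z i.succ - z 0)))
    (c := Fin.cons 0 1) (k := 0) (by simp)]
  · rw [Matrix.det_succ_column_zero, Fin.sum_univ_succ]
    simp
    rfl
  · intro i j
    refine Fin.cases ?_ (fun i => ?_) i <;> refine Fin.cases ?_ (fun j => ?_) j <;> simp

open scoped Pointwise in
/-- The volume of a simplex is proportional to the determinant of its homogenised vertices. -/
theorem volume_convexHull_range {d : ℕ} (z : Fin (d + 1) → Fin d → ℝ) :
    (volume (convexHull ℝ (Set.range z))).toReal = (volume (cornerSimplex d)).toReal *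
      |LinearMap.det (Fintype.linearCombination ℝ fun i => (Fin.cons 1 (z i) : Fin (d + 1) → ℝ))| := by
  rw [det_linearCombination_cons_one]
  set N := Fintype.linearCombination ℝ fun i : Fin d => z i.succ - z 0 with hN
  have h : convexHull ℝ (Set.range z) = (fun p => z 0 + p) '' (N '' cornerSimplex d) := by
    have h0 : convexHull ℝ (Set.range z) = z 0 +ᵥ N '' cornerSimplex d := by
      rw [cornerSimplex, LinearMap.image_convexHull, ← convexHull_vadd, ← Set.range_comp,
        ← Set.image_vadd, ← Set.range_comp]
      congr 2
      ext1 i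
      refine Fin.cases ?_ (fun i => ?_) i <;> simp [hN]
    exact h0
  rw [h, Set.image_add_left, measure_preimage_add, Measure.addHaar_image_linearMap,
    ENNReal.toReal_mul, ENNReal.toReal_ofReal (abs_nonneg _), mul_comm]

theorem exists_pos_forall_add_mul_pos {ι : Type*} (s : Finset ι) (a b : ι → ℝ)
    (ha : ∀ k ∈ s, 0 < a k) : ∃ ε > 0, ∀ δ, 0 < δ → δ ≤ ε → ∀ k ∈ s, 0 < a k + δ * b k := by
  have h : ∀ᶠ ε in nhds (0 : ℝ), ∀ k ∈ s, 0 < a k + ε * b k := by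
    rw [Filter.eventually_all_finset]
    intro k hk
    have hc : ContinuousAt (fun ε : ℝ => a k + ε * b k) 0 := by fun_prop
    exact hc.eventually_const_lt (by simpa using ha k hk)
  obtain ⟨ε, hε, h⟩ := Metric.eventually_nhds_iff.1 h
  refine ⟨ε / 2, by positivity, fun δ h0 h1 => h ?_⟩
  rw [Real.dist_eq, sub_zero, abs_of_pos h0]
  linarith

section Cones

variable {ι E : Type*} [AddCommGroup E] [Module ℝ E]

/-- The convex cone generated by the vectors `y k`, `k ∈ ρ`. -/
def coneOf (y : ι → E) (ρ : Finset ι) : Set E :=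
  {p | ∃ c : ι → ℝ, (∀ k, 0 ≤ c k) ∧ p = ∑ k ∈ ρ, c k • y k}

/-- A point lying on no proper subspace spanned by some of the vectors `y k`. -/
def AvoidsProperSpans (y : ι → E) (p : E) : Prop :=
  ∀ S : Finset ι, Submodule.span ℝ (y '' S) ≠ ⊤ → p ∉ Submodule.span ℝ (y '' S)

/-- A subdivision of the cone over `y` into simplicial cones on subfamilies of `y`, together with
the dual bases of its cells. -/
structure ConeTriangulation [Fintype ι] (y : ι → E) where
  cells : Finset (Finset ι)
  coord : Finset ι → ι → E →ₗ[ℝ] ℝ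
  sum_coord : ∀ σ ∈ cells, ∀ p, ∑ k ∈ σ, coord σ k p • y k = p
  coord_self : ∀ σ ∈ cells, ∀ i ∈ σ, coord σ i (y i) = 1
  coord_ne : ∀ σ ∈ cells, ∀ i ∈ σ, ∀ j ∈ σ, i ≠ j → coord σ i (y j) = 0
  covers : ∀ p ∈ coneOf y univ, ∃ σ ∈ cells, ∀ k ∈ σ, 0 ≤ coord σ k p
  disj : ∀ σ ∈ cells, ∀ τ ∈ cells, ∀ p, (∀ k ∈ σ, 0 < coord σ k p) →
    (∀ k ∈ τ, 0 < coord τ k p) → σ = τ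
  height : E →ₗ[ℝ] ℝ
  height_pos : ∀ k, 0 < height (y k)

theorem coneOf_add {y : ι → E} {ρ : Finset ι} {p q : E} (hp : p ∈ coneOf y ρ)
    (hq : q ∈ coneOf y ρ) : p + q ∈ coneOf y ρ := by
  obtain ⟨c, hc, rfl⟩ := hp
  obtain ⟨e, he, rfl⟩ := hq
  exact ⟨c + e, fun k => add_nonneg (hc k) (he k), by simp [add_smul, Finset.sum_add_distrib]⟩

theorem smul_mem_coneOf {y : ι → E} {ρ : Finset ι} {k : ι} (hk : k ∈ ρ) {a : ℝ} (ha : 0 ≤ a) :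
    a • y k ∈ coneOf y ρ := by
  classical
  refine ⟨Pi.single k a, fun j => ?_, ?_⟩
  · by_cases h : j = k
    · subst h; simpa using ha
    · simp [h]
  · rw [Finset.sum_eq_single k (fun j _ hj => by simp [hj]) (fun h => absurd hk h)]
    simp

theorem coneOf_mono {y : ι → E} {ρ ρ' : Finset ι} (h : ρ ⊆ ρ') : coneOf y ρ ⊆ coneOf y ρ' := by
  classical
  rintro p ⟨c, hc, rfl⟩
  refine ⟨fun k => if k ∈ ρ then c k else 0, fun k => ?_, ?_⟩
  · dsimp only; split_ifs
    · exact hc k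
    · rfl
  · simp only [ite_smul, zero_smul]
    rw [← Finset.sum_filter, Finset.filter_mem_eq_inter, Finset.inter_eq_right.2 h]

theorem nonneg_of_mem_coneOf {y : ι → E} {ρ : Finset ι} (f : E →ₗ[ℝ] ℝ)
    (hf : ∀ k ∈ ρ, 0 ≤ f (y k)) {p : E} (hp : p ∈ coneOf y ρ) : 0 ≤ f p := by
  obtain ⟨c, hc, rfl⟩ := hp
  rw [map_sum]
  exact Finset.sum_nonneg fun k hk => by
    rw [map_smul, smul_eq_mul]; exact mul_nonneg (hc k) (hf k hk)

theorem AvoidsProperSpans.notMem_of_vanish {y : ι → E} {p : E} (hp : AvoidsProperSpans y p)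
    {S : Finset ι} {f : E →ₗ[ℝ] ℝ} (hf : ∀ k ∈ S, f (y k) = 0) {z : E} (hz : f z ≠ 0) :
    p ∉ Submodule.span ℝ (y '' S) := by
  refine hp S fun htop => hz ?_
  have hle : Submodule.span ℝ (y '' S) ≤ LinearMap.ker f := by
    rw [Submodule.span_le]
    rintro _ ⟨k, hk, rfl⟩
    exact hf k hk
  rw [htop] at hle
  exact hle Submodule.mem_top

namespace ConeTriangulation

variable [Fintype ι] {y : ι → E} (T : ConeTriangulation y)

theorem mem_coneOf_iff {σ : Finset ι} (hσ : σ ∈ T.cells) {p : E} :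
    p ∈ coneOf y σ ↔ ∀ k ∈ σ, 0 ≤ T.coord σ k p := by
  classical
  constructor
  · intro hp k hk
    refine nonneg_of_mem_coneOf _ (fun j hj => ?_) hp
    by_cases h : k = j
    · subst h; rw [T.coord_self σ hσ k hk]; exact zero_le_one
    · rw [T.coord_ne σ hσ k hk j hj h]
  · intro h
    refine ⟨fun k => if k ∈ σ then T.coord σ k p else 0, fun k => ?_, ?_⟩
    · dsimp only; split_ifs with hk
      · exact h k hk
      · rfl
    · conv_lhs => rw [← T.sum_coord σ hσ p]
      exact Finset.sum_congr rfl fun k hk => by simp [hk]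

theorem coord_ne_zero {σ : Finset ι} (hσ : σ ∈ T.cells) {p : E} (hp : AvoidsProperSpans y p) {i : ι}
    (hi : i ∈ σ) : T.coord σ i p ≠ 0 := by
  classical
  intro h0
  refine hp.notMem_of_vanish (S := σ.erase i) (f := T.coord σ i) (z := y i) (fun k hk => ?_) ?_ ?_
  · exact T.coord_ne σ hσ i hi k (Finset.mem_of_mem_erase hk) (Finset.ne_of_mem_erase hk).symm
  · rw [T.coord_self σ hσ i hi]; exact one_ne_zero
  · rw [← T.sum_coord σ hσ p, ← Finset.add_sum_erase σ _ hi, h0, zero_smul, zero_add]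
    exact Submodule.sum_mem _ fun k hk =>
      Submodule.smul_mem _ _ (Submodule.subset_span ⟨k, hk, rfl⟩)

theorem coord_unique_zero {σ : Finset ι} (hσ : σ ∈ T.cells) {p : E} (hp : AvoidsProperSpans y p)
    (v : ι) (r : ℝ) {i j : ι} (hi : i ∈ σ) (hj : j ∈ σ)
    (hi0 : T.coord σ i (p - r • y v) = 0) (hj0 : T.coord σ j (p - r • y v) = 0) : i = j := by
  classical
  by_contra hij
  have hpi := T.coord_ne_zero hσ hp hi
  have hvi : T.coord σ i (y v) ≠ 0 := by
    intro h
    rw [map_sub, map_smul, h, smul_zero, sub_zero] at hi0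
    exact hpi hi0
  refine hp.notMem_of_vanish (S := insert v ((σ.erase i).erase j))
    (f := T.coord σ i (y v) • T.coord σ j - T.coord σ j (y v) • T.coord σ i) (z := y j)
    (fun k hk => ?_) ?_ ?_
  · rcases Finset.mem_insert.1 hk with rfl | hk
    · simp [mul_comm]
    · simp only [Finset.mem_erase] at hk
      simp [T.coord_ne σ hσ i hi k hk.2.2 (Ne.symm hk.2.1),
        T.coord_ne σ hσ j hj k hk.2.2 (Ne.symm hk.1)]
  · simpa [T.coord_self σ hσ j hj, T.coord_ne σ hσ i hi j hj hij] using hvi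
  · rw [← sub_add_cancel p (r • y v)]
    refine Submodule.add_mem _ ?_ (Submodule.smul_mem _ _ (Submodule.subset_span ⟨v, by simp, rfl⟩))
    rw [← T.sum_coord σ hσ (p - r • y v), ← Finset.add_sum_erase σ _ hi,
      ← Finset.add_sum_erase (σ.erase i) _ (Finset.mem_erase.2 ⟨Ne.symm hij, hj⟩), hi0, hj0,
      zero_smul, zero_smul, zero_add, zero_add]
    exact Submodule.sum_mem _ fun k hk =>
      Submodule.smul_mem _ _ (Submodule.subset_span ⟨k, by simp at hk ⊢; tauto, rfl⟩)

theorem existsUnique_cell {p : E} (hp : AvoidsProperSpans y p) (hpC : p ∈ coneOf y univ) :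
    ∃! σ, σ ∈ T.cells ∧ p ∈ coneOf y σ := by
  obtain ⟨σ, hσ, h⟩ := T.covers p hpC
  have hpos : ∀ τ ∈ T.cells, p ∈ coneOf y τ → ∀ k ∈ τ, 0 < T.coord τ k p := fun τ hτ hpτ k hk =>
    lt_of_le_of_ne ((T.mem_coneOf_iff hτ).1 hpτ k hk) (T.coord_ne_zero hτ hp hk).symm
  have hpσ := (T.mem_coneOf_iff hσ).2 h
  exact ⟨σ, ⟨hσ, hpσ⟩, fun τ ⟨hτ, hpτ⟩ => T.disj _ hτ _ hσ p (hpos τ hτ hpτ) (hpos σ hσ hpσ)⟩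

open Classical in
/-- The pairs `(σ, i)` such that the facet of the cell `σ` opposite to `i` lies on a supporting
hyperplane of the cone that avoids `y v`. -/
noncomputable def walls (v : ι) : Finset (Finset ι × ι) :=
  (T.cells ×ˢ univ).filter fun w => w.2 ∈ w.1 ∧ (∀ k, 0 ≤ T.coord w.1 w.2 (y k)) ∧
    0 < T.coord w.1 w.2 (y v)

theorem mem_walls {v : ι} {w : Finset ι × ι} : w ∈ T.walls v ↔
    w.1 ∈ T.cells ∧ w.2 ∈ w.1 ∧ (∀ k, 0 ≤ T.coord w.1 w.2 (y k)) ∧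
      0 < T.coord w.1 w.2 (y v) := by
  simp [walls]

open Classical in
/-- The cell spanned by `v` and the facet of `w.1` opposite to `w.2`. -/
noncomputable def starCell (v : ι) (w : Finset ι × ι) : Finset ι := insert v (w.1.erase w.2)

theorem exists_isGreatest (T : ConeTriangulation y) {p : E} (hpC : p ∈ coneOf y univ) (v : ι) :
    ∃ r, IsGreatest {r : ℝ | 0 ≤ r ∧ p - r • y v ∈ coneOf y univ} r := by
  have hset : {r : ℝ | 0 ≤ r ∧ p - r • y v ∈ coneOf y univ} =
      Set.Ici 0 ∩ ⋃ σ ∈ T.cells, ⋂ k ∈ σ, {r : ℝ | 0 ≤ T.coord σ k p - r * T.coord σ k (y v)} := by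
    ext r
    simp only [Set.mem_ofPred_eq, Set.mem_inter_iff, Set.mem_Ici, Set.mem_iUnion, Set.mem_iInter,
      exists_prop]
    refine and_congr_right fun _ => ⟨fun h => ?_, fun ⟨σ, hσ, h⟩ => ?_⟩
    · obtain ⟨σ, hσ, h⟩ := T.covers _ h
      exact ⟨σ, hσ, fun k hk => by simpa using h k hk⟩
    · exact coneOf_mono (Finset.subset_univ σ)
        ((T.mem_coneOf_iff hσ).2 fun k hk => by simpa using h k hk)
  have hclosed : IsClosed {r : ℝ | 0 ≤ r ∧ p - r • y v ∈ coneOf y univ} := by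
    rw [hset]
    refine isClosed_Ici.inter (isClosed_biUnion_finset fun σ _ => isClosed_biInter fun k _ => ?_)
    exact isClosed_le continuous_const (by fun_prop)
  refine IsCompact.exists_isGreatest ((isCompact_Icc (a := (0 : ℝ))
    (b := T.height p / T.height (y v))).of_isClosed_subset hclosed ?_) ⟨0, by simpa using hpC⟩
  rintro r ⟨h0, hr⟩
  refine ⟨h0, (le_div_iff₀ (T.height_pos v)).2 ?_⟩
  have := nonneg_of_mem_coneOf T.height (fun k _ => (T.height_pos k).le) hr
  simpa using this

theorem existsUnique_wall {p : E} (hp : AvoidsProperSpans y p) (hpC : p ∈ coneOf y univ) (v : ι) :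
    ∃! w, w ∈ T.walls v ∧ p ∈ coneOf y (starCell v w) := by
  classical
  obtain ⟨r, ⟨hr0, hrC⟩, hmax⟩ := T.exists_isGreatest hpC v
  set q := p - r • y v with hq
  have hnot : ∀ ε > (0 : ℝ), q - ε • y v ∉ coneOf y univ := by
    intro ε hε h
    have h1 : r + ε ≤ r := hmax ⟨by linarith, by rwa [add_smul, ← sub_sub]⟩
    linarith
  have huniq : ∀ σ ∈ T.cells, q ∈ coneOf y σ → ∀ i ∈ σ, T.coord σ i q = 0 →
      ∀ k ∈ σ.erase i, 0 < T.coord σ k q := by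
    intro σ hσ hqσ i hi hi0 k hk
    have hk' := Finset.mem_erase.1 hk
    refine lt_of_le_of_ne ((T.mem_coneOf_iff hσ).1 hqσ k hk'.2) fun h => hk'.1 ?_
    exact T.coord_unique_zero hσ hp v r hk'.2 hi h.symm hi0
  -- any wall whose star cell contains `p` is hit by the ray exactly at `q`
  have hwall : ∀ w ∈ T.walls v, p ∈ coneOf y (starCell v w) →
      q ∈ coneOf y w.1 ∧ T.coord w.1 w.2 q = 0 := by
    rintro ⟨σ, i⟩ hw hpw
    obtain ⟨hσ, hi, hnn, hv⟩ := T.mem_walls.1 hw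
    dsimp only at hσ hi hnn hv ⊢
    have hvi : v ∉ σ.erase i := by
      intro h
      have h' := Finset.mem_erase.1 h
      rw [T.coord_ne σ hσ i hi v h'.2 (Ne.symm h'.1)] at hv
      exact lt_irrefl _ hv
    obtain ⟨c, hc, hpc⟩ := hpw
    rw [starCell, Finset.sum_insert hvi] at hpc
    have hq' : p - c v • y v ∈ coneOf y (σ.erase i) := ⟨c, hc, by rw [hpc]; simp⟩
    have hq'0 : T.coord σ i (p - c v • y v) = 0 := by
      rw [hpc, add_sub_cancel_left, map_sum]
      refine Finset.sum_eq_zero fun k hk => ?_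
      have h' := Finset.mem_erase.1 hk
      rw [map_smul, T.coord_ne σ hσ i hi k h'.2 (Ne.symm h'.1), smul_zero]
    have h1 : c v ≤ r := hmax ⟨hc v, coneOf_mono (Finset.subset_univ _) hq'⟩
    have h2 : r ≤ c v := by
      have h3 := nonneg_of_mem_coneOf (T.coord σ i) (fun k _ => hnn k) hrC
      have h4 : q = (p - c v • y v) - (r - c v) • y v := by rw [hq, sub_smul]; abel
      rw [h4, map_sub, hq'0, map_smul, smul_eq_mul] at h3
      by_contra hlt
      have := mul_pos (sub_pos.2 (not_le.1 hlt)) hv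
      linarith
    have hrc : r = c v := le_antisymm h2 h1
    rw [hq, hrc]
    exact ⟨coneOf_mono (Finset.erase_subset i σ) hq', hq'0⟩
  obtain ⟨σ, hσ, hqσ⟩ := T.covers q hrC
  -- some coordinate of `q` vanishes and decreases when moving away from `y v`
  obtain ⟨i, hi, hi0, hvi⟩ : ∃ i ∈ σ, T.coord σ i q = 0 ∧ 0 < T.coord σ i (y v) := by
    by_contra! hcon
    obtain ⟨ε, hε, h⟩ := exists_pos_forall_add_mul_pos (σ.filter fun k => 0 < T.coord σ k q)
      (fun k => T.coord σ k q) (fun k => -T.coord σ k (y v)) (fun k hk => (Finset.mem_filter.1 hk).2)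
    refine hnot ε hε (coneOf_mono (Finset.subset_univ σ) ((T.mem_coneOf_iff hσ).2 fun k hk => ?_))
    rw [map_sub, map_smul, smul_eq_mul]
    rcases (hqσ k hk).eq_or_lt with h0 | h0
    · have := mul_nonneg hε.le (neg_nonneg.2 (hcon k hk h0.symm))
      linarith
    · have := h ε hε le_rfl k (Finset.mem_filter.2 ⟨hk, h0⟩)
      linarith
  have hqσ' := (T.mem_coneOf_iff hσ).2 hqσ
  have hposq := huniq σ hσ hqσ' i hi hi0
  have hnn : ∀ k, 0 ≤ T.coord σ i (y k) := by
    intro k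
    by_contra! hk
    set l := T.coord σ i (y v) / -T.coord σ i (y k) with hl
    have hl0 : 0 < l := div_pos hvi (by linarith)
    have hz : T.coord σ i (y v + l • y k) = 0 := by
      rw [map_add, map_smul, smul_eq_mul, hl]
      have hk' : -T.coord σ i (y k) ≠ 0 := by linarith
      linear_combination -div_mul_cancel₀ (T.coord σ i (y v)) hk'
    obtain ⟨ε, hε, h⟩ := exists_pos_forall_add_mul_pos (σ.erase i)
      (fun j => T.coord σ j q) (fun j => -T.coord σ j (y v + l • y k)) hposq
    refine hnot ε hε ?_
    have h1 : q - ε • y v = (q - ε • (y v + l • y k)) + (ε * l) • y k := by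
      rw [smul_add, smul_smul]; abel
    rw [h1]
    refine coneOf_add ?_ (smul_mem_coneOf (Finset.mem_univ k) (mul_pos hε hl0).le)
    refine coneOf_mono (Finset.subset_univ σ) ((T.mem_coneOf_iff hσ).2 fun j hj => ?_)
    rw [map_sub, map_smul, smul_eq_mul]
    by_cases hji : j = i
    · rw [hji, hi0, hz]; simp
    · have := h ε hε le_rfl j (Finset.mem_erase.2 ⟨hji, hj⟩)
      linarith
  refine ⟨(σ, i), ⟨T.mem_walls.2 ⟨hσ, hi, hnn, hvi⟩, ?_⟩, ?_⟩
  · have h1 : p = q + r • y v := by rw [hq]; abel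
    rw [h1]
    refine coneOf_add ?_ (smul_mem_coneOf (by simp [starCell]) hr0)
    have hqe : q ∈ coneOf y (σ.erase i) := by
      refine ⟨fun k => if k ∈ σ.erase i then T.coord σ k q else 0, fun k => ?_, ?_⟩
      · dsimp only; split_ifs with hk
        · exact (hposq k hk).le
        · rfl
      · conv_lhs => rw [← T.sum_coord σ hσ q, ← Finset.add_sum_erase σ _ hi, hi0, zero_smul,
          zero_add]
        exact Finset.sum_congr rfl fun k hk => by dsimp only; rw [if_pos hk]
    refine coneOf_mono ?_ hqe
    simp [starCell]
  · rintro ⟨σ', i'⟩ ⟨hw', hpw'⟩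
    obtain ⟨hqσ'', hi0'⟩ := hwall _ hw' hpw'
    obtain ⟨hσ', hi', -, hvi'⟩ := T.mem_walls.1 hw'
    dsimp only at hqσ'' hi0' hσ' hi' hvi'
    have hin : ∀ ρ ∈ T.cells, q ∈ coneOf y ρ → ∀ j ∈ ρ, T.coord ρ j q = 0 →
        0 < T.coord ρ j (y v) →
        ∃ ε > (0 : ℝ), ∀ δ : ℝ, 0 < δ → δ ≤ ε → ∀ k ∈ ρ, 0 < T.coord ρ k (q + δ • y v) := by
      intro ρ hρ hqρ j hj hj0 hvj
      obtain ⟨ε, hε, h⟩ := exists_pos_forall_add_mul_pos (ρ.erase j) (fun k => T.coord ρ k q)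
        (fun k => T.coord ρ k (y v)) (huniq ρ hρ hqρ j hj hj0)
      refine ⟨ε, hε, fun δ h0 h1 k hk => ?_⟩
      rw [map_add, map_smul, smul_eq_mul]
      by_cases hkj : k = j
      · rw [hkj, hj0, zero_add]; exact mul_pos h0 hvj
      · exact h δ h0 h1 k (Finset.mem_erase.2 ⟨hkj, hk⟩)
    obtain ⟨ε, hε, h⟩ := hin σ hσ hqσ' i hi hi0 hvi
    obtain ⟨ε', hε', h'⟩ := hin σ' hσ' hqσ'' i' hi' hi0' hvi'
    have hσσ : σ' = σ := T.disj σ' hσ' σ hσ (q + min ε ε' • y v)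
      (h' _ (lt_min hε hε') (min_le_right _ _)) (h _ (lt_min hε hε') (min_le_left _ _))
    subst hσσ
    rw [T.coord_unique_zero hσ hp v r hi' hi hi0' hi0]

theorem sum_indicator_cells_eq_sum_indicator_walls {p : E} (hp : AvoidsProperSpans y p) (v : ι)
    (f : E → ℝ) :
    ∑ σ ∈ T.cells, (coneOf y σ).indicator f p =
      ∑ w ∈ T.walls v, (coneOf y (starCell v w)).indicator f p := by
  by_cases hpC : p ∈ coneOf y univ
  · obtain ⟨σ, ⟨hσ, hpσ⟩, hσu⟩ := T.existsUnique_cell hp hpC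
    obtain ⟨w, ⟨hw, hpw⟩, hwu⟩ := T.existsUnique_wall hp hpC v
    rw [Finset.sum_eq_single_of_mem σ hσ fun τ hτ hne => Set.indicator_of_notMem
        (fun h => hne (hσu τ ⟨hτ, h⟩)) _,
      Finset.sum_eq_single_of_mem w hw fun u hu hne => Set.indicator_of_notMem
        (fun h => hne (hwu u ⟨hu, h⟩)) _,
      Set.indicator_of_mem hpσ, Set.indicator_of_mem hpw]
  · rw [Finset.sum_eq_zero fun σ _ => Set.indicator_of_notMem
        (fun h => hpC (coneOf_mono (Finset.subset_univ _) h)) _,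
      Finset.sum_eq_zero fun w _ => Set.indicator_of_notMem
        (fun h => hpC (coneOf_mono (Finset.subset_univ _) h)) _]

end ConeTriangulation

end Cones

/-- The homogenisation `(1, x_k)` of the point `x_k`. -/
def homog {d m : ℕ} (x : Fin m → Fin d → ℝ) (k : Fin m) : Fin (d + 1) → ℝ := Fin.cons 1 (x k)

/-- The inclusion `u ↦ (0, u)`. -/
def consZero (d : ℕ) : (Fin d → ℝ) →ₗ[ℝ] (Fin (d + 1) → ℝ) where
  toFun u := Fin.cons 0 u
  map_add' u w := by ext j; refine Fin.cases ?_ (fun j => ?_) j <;> simp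
  map_smul' a u := by ext j; refine Fin.cases ?_ (fun j => ?_) j <;> simp

theorem cons_one_eq {d : ℕ} (u : Fin d → ℝ) :
    (Fin.cons 1 u : Fin (d + 1) → ℝ) = Fin.cons 1 0 + consZero d u := by
  ext j
  refine Fin.cases ?_ (fun j => ?_) j <;> simp [consZero]

theorem smul_mem_coneOf_of_mem {ι E : Type*} [AddCommGroup E] [Module ℝ E] {y : ι → E}
    {ρ : Finset ι} {p : E} (hp : p ∈ coneOf y ρ) {a : ℝ} (ha : 0 ≤ a) : a • p ∈ coneOf y ρ := by
  obtain ⟨c, hc, rfl⟩ := hp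
  exact ⟨fun k => a * c k, fun k => mul_nonneg ha (hc k), by simp [Finset.smul_sum, mul_smul]⟩

theorem mem_convexHull_iff_cons_one_mem_coneOf {d m : ℕ} (x : Fin m → Fin d → ℝ)
    (S : Finset (Fin m)) (u : Fin d → ℝ) :
    u ∈ convexHull ℝ (x '' ↑S) ↔ (Fin.cons 1 u : Fin (d + 1) → ℝ) ∈ coneOf (homog x) S := by
  constructor
  · intro hu
    have hsub : convexHull ℝ (x '' ↑S) ⊆
        {u | (Fin.cons 1 u : Fin (d + 1) → ℝ) ∈ coneOf (homog x) S} := by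
      refine convexHull_min ?_ ?_
      · rintro _ ⟨k, hk, rfl⟩
        have h := smul_mem_coneOf (y := homog x) (Finset.mem_coe.1 hk) zero_le_one
        rwa [one_smul] at h
      · intro u hu w hw a b ha hb hab
        have h : (Fin.cons 1 (a • u + b • w) : Fin (d + 1) → ℝ) =
            a • (Fin.cons 1 u : Fin (d + 1) → ℝ) + b • (Fin.cons 1 w : Fin (d + 1) → ℝ) := by
          ext j
          refine Fin.cases ?_ (fun j => ?_) j <;> simp [hab]
        rw [Set.mem_ofPred_eq, h]
        exact coneOf_add (smul_mem_coneOf_of_mem hu ha) (smul_mem_coneOf_of_mem hw hb)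
    exact hsub hu
  · rintro ⟨c, hc, h⟩
    have h1 : ∑ k ∈ S, c k = 1 := by
      have := congrFun h 0
      simpa [homog, Finset.sum_apply, eq_comm] using this
    have h2 : u = ∑ k ∈ S, c k • x k := by
      ext j
      have := congrFun h j.succ
      simpa [homog, Finset.sum_apply] using this
    rw [h2]
    exact (convex_convexHull ℝ _).sum_mem (fun k _ => hc k) h1
      fun k hk => subset_convexHull ℝ _ ⟨k, hk, rfl⟩

theorem linearIndepOn_homog {d m : ℕ} {x : Fin m → Fin d → ℝ} {σ : Finset (Fin m)}
    (h : AffineIndependent ℝ (fun k : {k // k ∈ σ} => x k.1)) :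
    LinearIndependent ℝ (fun k : {k // k ∈ σ} => homog x k.1) := by
  rw [Fintype.linearIndependent_iff]
  intro g hg k
  refine affineIndependent_iff.1 h univ g ?_ ?_ k (Finset.mem_univ k)
  · have := congrFun hg 0
    simpa [homog, Finset.sum_apply] using this
  · ext j
    have := congrFun hg j.succ
    simpa [homog, Finset.sum_apply] using this

theorem exists_dual_family {d m : ℕ} {x : Fin m → Fin d → ℝ} {σ : Finset (Fin m)}
    (hcard : σ.card = d + 1)
    (h : AffineIndependent ℝ (fun k : {k // k ∈ σ} => x k.1)) :
    ∃ β : Fin m → (Fin (d + 1) → ℝ) →ₗ[ℝ] ℝ,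
      (∀ p, ∑ k ∈ σ, β k p • homog x k = p) ∧ (∀ i ∈ σ, β i (homog x i) = 1) ∧
        ∀ i ∈ σ, ∀ j ∈ σ, i ≠ j → β i (homog x j) = 0 := by
  classical
  have : Nonempty {k // k ∈ σ} := by
    obtain ⟨k, hk⟩ := Finset.card_pos.1 (by omega : 0 < σ.card)
    exact ⟨⟨k, hk⟩⟩
  set B := basisOfLinearIndependentOfCardEqFinrank (linearIndepOn_homog h) (by simp [hcard])
    with hB
  have hBk : ∀ k, B k = homog x k.1 := fun k => by simp [hB]
  refine ⟨fun k => if hk : k ∈ σ then B.coord ⟨k, hk⟩ else 0, fun p => ?_, fun i hi => ?_,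
    fun i hi j hj hij => ?_⟩
  · conv_rhs => rw [← B.sum_repr p]
    rw [← Finset.sum_coe_sort]
    exact Finset.sum_congr rfl fun k _ => by simp [hBk]
  · simp only [hi, dif_pos]
    rw [← hBk ⟨i, hi⟩]
    simp
  · simp only [hi, dif_pos]
    rw [← hBk ⟨j, hj⟩]
    simp [Ne.symm hij]

theorem mem_interior_convexHull_of_coord_pos {d m : ℕ} {x : Fin m → Fin d → ℝ}
    {σ : Finset (Fin m)} {β : Fin m → (Fin (d + 1) → ℝ) →ₗ[ℝ] ℝ}
    (hβ : ∀ p, ∑ k ∈ σ, β k p • homog x k = p) {u : Fin d → ℝ}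
    (hu : ∀ k ∈ σ, 0 < β k (Fin.cons 1 u)) : u ∈ interior (convexHull ℝ (x '' ↑σ)) := by
  classical
  have hopen : IsOpen (⋂ k ∈ σ, {u : Fin d → ℝ | 0 < β k (Fin.cons 1 u)}) := by
    refine isOpen_biInter_finset fun k _ => isOpen_lt continuous_const ?_
    have h : (fun u : Fin d → ℝ => β k (Fin.cons 1 u)) =
        fun u => β k (Fin.cons 1 0) + β k (consZero d u) :=
      funext fun u => by rw [cons_one_eq u, map_add]
    rw [h]
    exact continuous_const.add
      (((β k).comp (consZero d)).continuous_of_finiteDimensional)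
  refine mem_interior.2 ⟨_, fun w hw => ?_, hopen, Set.mem_iInter₂.2 hu⟩
  rw [mem_convexHull_iff_cons_one_mem_coneOf]
  have hw' : ∀ k ∈ σ, 0 < β k (Fin.cons 1 w) := Set.mem_iInter₂.1 hw
  refine ⟨fun k => if k ∈ σ then β k (Fin.cons 1 w) else 0, fun k => ?_, ?_⟩
  · dsimp only; split_ifs with hk
    · exact (hw' k hk).le
    · rfl
  · conv_lhs => rw [← hβ (Fin.cons 1 w)]
    exact Finset.sum_congr rfl fun k hk => by simp [hk]

theorem eq_smul_cons_one {d : ℕ} {p : Fin (d + 1) → ℝ} (hp : p 0 ≠ 0) :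
    (p 0)⁻¹ • p = Fin.cons 1 ((p 0)⁻¹ • Fin.tail p) := by
  ext j
  refine Fin.cases ?_ (fun j => ?_) j
  · simp [hp]
  · simp [Fin.tail]

/-- A triangulation of a polytope homogenises to a triangulation of the cone over it. -/
theorem Triangulation.exists_coneTriangulation {d m : ℕ} {x : Fin m → Fin d → ℝ}
    (T : Triangulation d m x) (hT : T.simplices.Nonempty) :
    ∃ T' : ConeTriangulation (homog x), T'.cells = T.simplices := by
  classical
  choose! β hsum hself hne using
    fun (σ : Finset (Fin m)) (hσ : σ ∈ T.simplices) =>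
      exists_dual_family (T.card_eq σ hσ) (T.indep σ hσ)
  refine ⟨⟨T.simplices, β, hsum, hself, hne, ?_, ?_, LinearMap.proj 0, fun k => by simp [homog]⟩,
    rfl⟩
  · intro p hp
    have hp0 : 0 ≤ p 0 :=
      nonneg_of_mem_coneOf (LinearMap.proj 0) (fun k _ => by simp [homog]) hp
    rcases hp0.eq_or_lt with h0 | h0
    · obtain ⟨c, hc, rfl⟩ := hp
      have hc0 : ∀ k ∈ univ, c k = 0 := by
        rw [← Finset.sum_eq_zero_iff_of_nonneg fun k _ => hc k]
        simpa [homog, Finset.sum_apply, eq_comm] using h0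
      obtain ⟨σ, hσ⟩ := hT
      refine ⟨σ, hσ, fun k _ => ?_⟩
      rw [Finset.sum_eq_zero fun k hk => by rw [hc0 k hk, zero_smul], map_zero]
    · have h1 := smul_mem_coneOf_of_mem hp (inv_nonneg.2 hp0)
      rw [eq_smul_cons_one h0.ne', ← mem_convexHull_iff_cons_one_mem_coneOf, Finset.coe_univ,
        Set.image_univ, ← T.covers] at h1
      simp only [Set.mem_iUnion, exists_prop] at h1
      obtain ⟨σ, hσ, h1⟩ := h1
      refine ⟨σ, hσ, fun k hk => ?_⟩
      rw [mem_convexHull_iff_cons_one_mem_coneOf, ← eq_smul_cons_one h0.ne'] at h1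
      have h2 := nonneg_of_mem_coneOf (β σ k) (fun j hj => ?_) h1
      · rw [map_smul, smul_eq_mul] at h2
        exact nonneg_of_mul_nonneg_right h2 (inv_pos.2 h0)
      · by_cases hkj : k = j
        · subst hkj; rw [hself σ hσ k hk]; exact zero_le_one
        · rw [hne σ hσ k hk j hj hkj]
  · intro σ hσ τ hτ p hpσ hpτ
    have hp0 : 0 < p 0 := by
      obtain ⟨k, hk⟩ := Finset.card_pos.1 (by rw [T.card_eq σ hσ]; omega : 0 < σ.card)
      have h := congrFun (hsum σ hσ p) 0
      rw [← h]
      simp only [homog, Finset.sum_apply, Pi.smul_apply, Fin.cons_zero, smul_eq_mul, mul_one]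
      exact Finset.sum_pos (fun k hk => hpσ k hk) ⟨k, hk⟩
    by_contra hστ
    have hmem : ∀ ρ ∈ T.simplices, (∀ k ∈ ρ, 0 < β ρ k p) →
        (p 0)⁻¹ • Fin.tail p ∈ interior (convexHull ℝ (x '' ↑ρ)) := by
      intro ρ hρ h
      refine mem_interior_convexHull_of_coord_pos (hsum ρ hρ) fun k hk => ?_
      rw [← eq_smul_cons_one hp0.ne', map_smul, smul_eq_mul]
      exact mul_pos (inv_pos.2 hp0) (h k hk)
    have : (p 0)⁻¹ • Fin.tail p ∈ (∅ : Set (Fin d → ℝ)) := by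
      rw [← T.disj σ hσ τ hτ hστ]
      exact ⟨hmem σ hσ hpσ, hmem τ hτ hpτ⟩
    exact this

theorem exists_forced_vertex {d m : ℕ} {x : Fin m → Fin d → ℝ} {τ : Finset (Fin m)}
    (hτ : ¬ IsFaceVtxSet d m x τ) :
    ∃ v, v ∉ τ ∧ ∀ ψ : (Fin (d + 1) → ℝ) →ₗ[ℝ] ℝ, (∀ k, 0 ≤ ψ (homog x k)) →
      (∀ k ∈ τ, ψ (homog x k) = 0) → ψ (homog x v) = 0 := by
  classical
  by_contra! hcon
  choose! ψ hnn hz hne using hcon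
  refine hτ ?_
  set Ψ := ∑ v ∈ τᶜ, ψ v with hΨ
  have hΨnn : ∀ k, 0 ≤ Ψ (homog x k) := fun k => by
    rw [hΨ, LinearMap.sum_apply]
    exact Finset.sum_nonneg fun v hv => hnn v (Finset.mem_compl.1 hv) k
  have hΨz : ∀ k, Ψ (homog x k) = 0 ↔ k ∈ τ := fun k => by
    rw [hΨ, LinearMap.sum_apply, Finset.sum_eq_zero_iff_of_nonneg
      fun v hv => hnn v (Finset.mem_compl.1 hv) k]
    constructor
    · intro h
      by_contra hk
      exact hne k hk (h k (Finset.mem_compl.2 hk))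
    · exact fun hk v hv => hz v (Finset.mem_compl.1 hv) k hk
  have hP : ∀ u ∈ convexHull ℝ (Set.range x), 0 ≤ Ψ (Fin.cons 1 u) := by
    intro u hu
    rw [← Set.image_univ, ← Finset.coe_univ, mem_convexHull_iff_cons_one_mem_coneOf] at hu
    exact nonneg_of_mem_coneOf Ψ (fun k _ => hΨnn k) hu
  refine ⟨{u ∈ convexHull ℝ (Set.range x) | Ψ (Fin.cons 1 u) = 0}, ?_, ?_⟩
  · rintro ⟨u₀, hu₀, hu₀'⟩
    refine ⟨LinearMap.toContinuousLinearMap (-(Ψ.comp (consZero d))), ?_⟩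
    have hl : ∀ u w, (LinearMap.toContinuousLinearMap (-(Ψ.comp (consZero d)))) u ≤
        (LinearMap.toContinuousLinearMap (-(Ψ.comp (consZero d)))) w ↔
          Ψ (Fin.cons 1 w) ≤ Ψ (Fin.cons 1 u) := by
      intro u w
      rw [cons_one_eq u, cons_one_eq w]
      simp
    ext u
    simp only [Set.mem_ofPred_eq, hl]
    refine and_congr_right fun hu => ⟨fun h w hw => ?_, fun h => ?_⟩
    · rw [h]; exact hP w hw
    · exact le_antisymm (hu₀' ▸ h u₀ hu₀) (hP u hu)
  · ext u
    constructor
    · rintro ⟨k, hk, rfl⟩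
      exact ⟨⟨subset_convexHull ℝ _ ⟨k, rfl⟩, (hΨz k).2 hk⟩, k, rfl⟩
    · rintro ⟨⟨-, hk⟩, k, rfl⟩
      exact ⟨k, (hΨz k).1 hk, rfl⟩

theorem coneOf_map_eq_image {ι E : Type*} [AddCommGroup E] [Module ℝ E] {n : ℕ} (y : ι → E)
    (e : Fin n ↪ ι) :
    coneOf y (univ.map e) = Fintype.linearCombination ℝ (fun i => y (e i)) '' Set.Ici 0 := by
  ext p
  constructor
  · rintro ⟨c, hc, rfl⟩
    exact ⟨fun i => c (e i), fun i => hc _, by simp [Fintype.linearCombination_apply]⟩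
  · rintro ⟨c, hc, rfl⟩
    refine ⟨Function.extend e c 0, fun k => ?_, ?_⟩
    · by_cases h : ∃ i, e i = k
      · obtain ⟨i, rfl⟩ := h
        rw [e.injective.extend_apply]
        exact hc i
      · rw [Function.extend_apply' _ _ _ h]
        rfl
    · simp [Fintype.linearCombination_apply, e.injective.extend_apply]

theorem injective_linearCombination_of_linearIndepOn {ι E : Type*} [AddCommGroup E] [Module ℝ E]
    {n : ℕ} {y : ι → E} {e : Fin n ↪ ι}
    (h : LinearIndepOn ℝ y (univ.map e : Finset ι)) :
    Function.Injective (Fintype.linearCombination ℝ fun i => y (e i)) := by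
  rw [← linearIndependent_iff_injective_fintypeLinearCombination]
  exact h.comp (fun i => ⟨e i, by simp⟩) fun i j hij => e.injective (by simpa using hij)

theorem exists_embedding_of_card {ι : Type*} {n : ℕ} {ρ : Finset ι} (h : ρ.card = n) :
    ∃ e : Fin n ↪ ι, univ.map e = ρ := by
  classical
  refine ⟨(ρ.equivFinOfCardEq h).symm.toEmbedding.trans (Function.Embedding.subtype _), ?_⟩
  ext k
  simp only [Finset.mem_map, Finset.mem_univ, true_and]
  constructor
  · rintro ⟨i, rfl⟩
    exact Subtype.property _
  · exact fun hk => ⟨ρ.equivFinOfCardEq h ⟨k, hk⟩, by simp⟩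

/-- The exponential mass of the simplicial cone over the points `x_k`, `k ∈ ρ`. -/
noncomputable def coneMass {d m : ℕ} (x : Fin m → Fin d → ℝ) (ρ : Finset (Fin m)) : ℝ :=
  ∫ p in coneOf (homog x) ρ, Real.exp (-(p 0))

theorem coneMass_map {d m : ℕ} {x : Fin m → Fin d → ℝ} {e : Fin (d + 1) ↪ Fin m}
    (h : LinearIndepOn ℝ (homog x) (univ.map e : Finset (Fin m))) :
    coneMass x (univ.map e) =
      |LinearMap.det (Fintype.linearCombination ℝ fun i => homog x (e i))| := by
  rw [coneMass, coneOf_map_eq_image]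
  have := (integral_exp_simplicialCone _ (injective_linearCombination_of_linearIndepOn h)
    (LinearMap.proj 0) (fun i => by simp [homog])).2
  simpa [homog] using this

theorem integral_exp_coneOf {d m : ℕ} {x : Fin m → Fin d → ℝ} {ρ : Finset (Fin m)}
    (hcard : ρ.card = d + 1) (h : LinearIndepOn ℝ (homog x) ρ)
    (s : (Fin (d + 1) → ℝ) →ₗ[ℝ] ℝ) (hs : ∀ k, 0 < s (homog x k)) :
    Integrable ((coneOf (homog x) ρ).indicator fun p => Real.exp (-(s p))) ∧
      ∫ p, (coneOf (homog x) ρ).indicator (fun p => Real.exp (-(s p))) p =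
        coneMass x ρ * ∏ k ∈ ρ, (s (homog x k))⁻¹ := by
  obtain ⟨e, rfl⟩ := exists_embedding_of_card hcard
  have hinj := injective_linearCombination_of_linearIndepOn h
  have hmeas : MeasurableSet (coneOf (homog x) (univ.map e)) := by
    rw [coneOf_map_eq_image]
    exact measurableSet_Ici.image_of_continuousOn_injOn
      (LinearMap.continuous_of_finiteDimensional _).continuousOn hinj.injOn
  rw [integrable_indicator_iff hmeas, integral_indicator hmeas, coneMass_map h,
    coneOf_map_eq_image, Finset.prod_map]
  exact integral_exp_simplicialCone _ hinj s fun i => hs _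

theorem volume_convexHull_eq_mul_coneMass {d m : ℕ} {x : Fin m → Fin d → ℝ} {σ : Finset (Fin m)}
    (hcard : σ.card = d + 1) (h : LinearIndepOn ℝ (homog x) σ) :
    (volume (convexHull ℝ (x '' ↑σ))).toReal =
      (volume (cornerSimplex d)).toReal * coneMass x σ := by
  obtain ⟨e, rfl⟩ := exists_embedding_of_card hcard
  rw [coneMass_map h, Finset.coe_map, Finset.coe_univ, Set.image_univ, ← Set.range_comp]
  exact volume_convexHull_range (x ∘ e)

theorem ae_avoidsProperSpans {ι : Type*} [Finite ι] {n : ℕ} (y : ι → Fin n → ℝ) :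
    ∀ᵐ p, AvoidsProperSpans y p := by
  simp only [AvoidsProperSpans]
  rw [ae_all_iff]
  intro S
  by_cases h : Submodule.span ℝ (y '' S) = ⊤
  · simp [h]
  · filter_upwards [measure_eq_zero_iff_ae_notMem.1 (Measure.addHaar_submodule volume _ h)]
      with p hp _ using hp

namespace ConeTriangulation

section

variable {ι E : Type*} [AddCommGroup E] [Module ℝ E] [Fintype ι] {y : ι → E}
  (T : ConeTriangulation y)

theorem linearIndepOn_cell {σ : Finset ι} (hσ : σ ∈ T.cells) : LinearIndepOn ℝ y σ := by
  classical
  rw [linearIndepOn_finset_iff]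
  intro c hc i hi
  have h := congrArg (T.coord σ i) hc
  rw [map_sum, map_zero, Finset.sum_eq_single i] at h
  · simpa [T.coord_self σ hσ i hi] using h
  · intro j hj hji
    rw [map_smul, T.coord_ne σ hσ i hi j hj hji.symm, smul_zero]
  · exact fun h => absurd hi h

theorem notMem_erase_of_mem_walls {v : ι} {w : Finset ι × ι} (hw : w ∈ T.walls v)
    [DecidableEq ι] : v ∉ w.1.erase w.2 := by
  obtain ⟨hσ, hi, -, hv⟩ := T.mem_walls.1 hw
  intro h
  have h' := Finset.mem_erase.1 h
  rw [T.coord_ne _ hσ _ hi v h'.2 (Ne.symm h'.1)] at hv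
  exact lt_irrefl _ hv

theorem card_starCell {v : ι} {w : Finset ι × ι} (hw : w ∈ T.walls v) :
    (starCell v w).card = w.1.card := by
  classical
  have hi := (T.mem_walls.1 hw).2.1
  have hv := T.notMem_erase_of_mem_walls hw
  have : starCell v w = insert v (w.1.erase w.2) := by
    ext; simp [starCell]
  rw [this, Finset.card_insert_of_notMem hv, Finset.card_erase_add_one hi]

theorem linearIndepOn_starCell {v : ι} {w : Finset ι × ι} (hw : w ∈ T.walls v) :
    LinearIndepOn ℝ y (starCell v w) := by
  classical
  obtain ⟨hσ, hi, -, hv⟩ := T.mem_walls.1 hw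
  have hve := T.notMem_erase_of_mem_walls hw
  have : starCell v w = insert v (w.1.erase w.2) := by
    ext; simp [starCell]
  rw [this, linearIndepOn_finset_iff]
  intro c hc
  rw [Finset.sum_insert hve] at hc
  have h := congrArg (T.coord w.1 w.2) hc
  rw [map_add, map_sum, map_zero, Finset.sum_eq_zero, add_zero, map_smul, smul_eq_mul] at h
  · have hcv : c v = 0 := (mul_eq_zero.1 h).resolve_right hv.ne'
    rw [hcv, zero_smul, zero_add] at hc
    have hind := linearIndepOn_finset_iff.1
      ((T.linearIndepOn_cell hσ).mono (Finset.coe_subset.2 (Finset.erase_subset w.2 w.1))) c hc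
    intro k hk
    rcases Finset.mem_insert.1 hk with rfl | hk
    · exact hcv
    · exact hind k hk
  · intro k hk
    have h' := Finset.mem_erase.1 hk
    rw [map_smul, T.coord_ne _ hσ _ hi k h'.2 (Ne.symm h'.1), smul_zero]

end

theorem sum_coneMass_cells_eq_sum_coneMass_walls {d m : ℕ} {x : Fin m → Fin d → ℝ}
    (T : ConeTriangulation (homog x)) (hcard : ∀ σ ∈ T.cells, σ.card = d + 1) (v : Fin m)
    (s : (Fin (d + 1) → ℝ) →ₗ[ℝ] ℝ) (hs : ∀ k, 0 < s (homog x k)) :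
    ∑ σ ∈ T.cells, coneMass x σ * ∏ k ∈ σ, (s (homog x k))⁻¹ =
      ∑ w ∈ T.walls v, coneMass x (starCell v w) * ∏ k ∈ starCell v w, (s (homog x k))⁻¹ := by
  have hc := fun σ hσ => integral_exp_coneOf (hcard σ hσ) (T.linearIndepOn_cell hσ) s hs
  have hw := fun w (hw : w ∈ T.walls v) => integral_exp_coneOf
    ((T.card_starCell hw).trans (hcard _ (T.mem_walls.1 hw).1)) (T.linearIndepOn_starCell hw) s hs
  rw [← Finset.sum_congr rfl fun σ hσ => (hc σ hσ).2,
    ← Finset.sum_congr rfl fun w hw' => (hw w hw').2,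
    ← integral_finsetSum _ fun σ hσ => (hc σ hσ).1, ← integral_finsetSum _ fun w hw' => (hw w hw').1]
  refine integral_congr_ae ?_
  filter_upwards [ae_avoidsProperSpans (homog x)] with p hp
  exact T.sum_indicator_cells_eq_sum_indicator_walls hp v _

end ConeTriangulation

/-- The linear functional `(p₀, p) ↦ p₀ − p · t`. -/
noncomputable def affineForm {d : ℕ} (t : Fin d → ℝ) : (Fin (d + 1) → ℝ) →ₗ[ℝ] ℝ :=
  LinearMap.proj 0 - ∑ j, t j • LinearMap.proj j.succ

theorem affineForm_homog {d m : ℕ} (x : Fin m → Fin d → ℝ) (t : Fin d → ℝ) (k : Fin m) :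
    affineForm t (homog x k) = 1 - ∑ j, x k j * t j := by
  simp [affineForm, homog, LinearMap.sum_apply, mul_comm]

theorem eval_Lpoly {d m : ℕ} (x : Fin m → Fin d → ℝ) (t : Fin d → ℝ) (k : Fin m) :
    MvPolynomial.eval t (Lpoly d m x k) = 1 - ∑ j, x k j * t j := by
  simp [Lpoly]

/-- The polynomial `∑ a, mass (ρ a) ∏_{k ∉ ρ a} ℒ_k` attached to a family of simplicial cones. -/
noncomputable def coneAdjoint {d m : ℕ} {A : Type*} (x : Fin m → Fin d → ℝ) (I : Finset A)
    (ρ : A → Finset (Fin m)) : MvPolynomial (Fin d) ℝ :=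
  ∑ a ∈ I, MvPolynomial.C (coneMass x (ρ a)) * ∏ k ∈ (ρ a)ᶜ, Lpoly d m x k

theorem eval_coneAdjoint {d m : ℕ} {A : Type*} (x : Fin m → Fin d → ℝ) (I : Finset A)
    (ρ : A → Finset (Fin m)) {t : Fin d → ℝ} (ht : ∀ k, 0 < affineForm t (homog x k)) :
    MvPolynomial.eval t (coneAdjoint x I ρ) = (∏ k, affineForm t (homog x k)) *
      ∑ a ∈ I, coneMass x (ρ a) * ∏ k ∈ ρ a, (affineForm t (homog x k))⁻¹ := by
  rw [coneAdjoint, map_sum, Finset.mul_sum]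
  refine Finset.sum_congr rfl fun a _ => ?_
  rw [map_mul, MvPolynomial.eval_C, map_prod, ← Finset.prod_mul_prod_compl (ρ a),
    Finset.prod_inv_distrib]
  simp_rw [eval_Lpoly, ← affineForm_homog]
  have h : ∏ k ∈ ρ a, affineForm t (homog x k) ≠ 0 := Finset.prod_ne_zero_iff.2 fun k _ => (ht k).ne'
  field_simp

theorem coneAdjoint_cells_eq_coneAdjoint_walls {d m : ℕ} {x : Fin m → Fin d → ℝ}
    (T : ConeTriangulation (homog x)) (hcard : ∀ σ ∈ T.cells, σ.card = d + 1) (v : Fin m) :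
    coneAdjoint x T.cells id = coneAdjoint x (T.walls v) (ConeTriangulation.starCell v) := by
  have h : ∀ᶠ t in nhds (0 : Fin d → ℝ), ∀ k, 0 < affineForm t (homog x k) := by
    rw [Filter.eventually_all]
    intro k
    have hc : ContinuousAt (fun t : Fin d → ℝ => affineForm t (homog x k)) 0 := by
      simp_rw [affineForm_homog]
      exact (continuous_const.sub (continuous_finsetSum _ fun j _ =>
        continuous_const.mul (continuous_apply j))).continuousAt
    exact hc.eventually_const_lt (by simp [affineForm_homog])
  obtain ⟨ε, hε, h⟩ := Metric.eventually_nhds_iff.1 h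
  refine MvPolynomial.funext_set (fun _ => Metric.ball (0 : ℝ) ε) (fun _ => ?_) fun t ht => ?_
  · rw [Real.ball_eq_Ioo]
    exact Set.Ioo_infinite (by linarith)
  · have ht' := h ((dist_pi_lt_iff hε).2 fun j => ht j (Set.mem_univ j))
    rw [eval_coneAdjoint _ _ _ ht', eval_coneAdjoint _ _ _ ht']
    exact congrArg _ (T.sum_coneMass_cells_eq_sum_coneMass_walls hcard v _ ht')

theorem totalDegree_Lpoly_le {d m : ℕ} (x : Fin m → Fin d → ℝ) (k : Fin m) :
    (Lpoly d m x k).totalDegree ≤ 1 := by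
  refine (MvPolynomial.totalDegree_sub _ _).trans (max_le (by simp) ?_)
  refine MvPolynomial.totalDegree_finsetSum_le fun j _ => ?_
  refine (MvPolynomial.totalDegree_mul _ _).trans ?_
  simp

theorem totalDegree_adjoint_le {d m : ℕ} {x : Fin m → Fin d → ℝ} (T : Triangulation d m x) :
    (adjoint d m x T).totalDegree ≤ m - d - 1 := by
  refine MvPolynomial.totalDegree_finsetSum_le fun σ hσ => ?_
  refine (MvPolynomial.totalDegree_mul _ _).trans ?_
  rw [MvPolynomial.totalDegree_C, zero_add]
  refine (MvPolynomial.totalDegree_finsetProd _ _).trans ?_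
  refine (Finset.sum_le_card_nsmul _ _ 1 fun k _ => totalDegree_Lpoly_le x k).trans ?_
  rw [Finset.card_compl, T.card_eq σ hσ, Fintype.card_fin, smul_eq_mul]
  omega

theorem adjoint_eq_mul_coneAdjoint {d m : ℕ} {x : Fin m → Fin d → ℝ} (T : Triangulation d m x) :
    adjoint d m x T = MvPolynomial.C ((volume (cornerSimplex d)).toReal /
      (volume (convexHull ℝ (Set.range x))).toReal) * coneAdjoint x T.simplices id := by
  rw [adjoint, coneAdjoint, Finset.mul_sum]
  refine Finset.sum_congr rfl fun σ hσ => ?_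
  rw [volume_convexHull_eq_mul_coneMass (T.card_eq σ hσ) (linearIndepOn_homog (T.indep σ hσ)),
    ← mul_assoc, ← map_mul, mul_div_right_comm, id]

theorem eval_adjoint_eq_zero {d m : ℕ} {x : Fin m → Fin d → ℝ} (T : Triangulation d m x)
    {τ : Finset (Fin m)} (hτ : ¬ IsFaceVtxSet d m x τ) {t : Fin d → ℝ}
    (ht : ∀ k ∈ τ, 1 - ∑ j, x k j * t j = 0) :
    MvPolynomial.eval t (adjoint d m x T) = 0 := by
  classical
  rcases T.simplices.eq_empty_or_nonempty with hT | hT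
  · simp [adjoint, hT]
  obtain ⟨T', hT'⟩ := T.exists_coneTriangulation hT
  obtain ⟨v, hv, hforce⟩ := exists_forced_vertex hτ
  rw [adjoint_eq_mul_coneAdjoint, ← hT',
    coneAdjoint_cells_eq_coneAdjoint_walls T' (hT' ▸ T.card_eq) v, map_mul, coneAdjoint, map_sum,
    Finset.sum_eq_zero, mul_zero]
  intro w hw
  obtain ⟨hσ, hi, hnn, hpos⟩ := T'.mem_walls.1 hw
  obtain ⟨k, hkτ, hk⟩ : ∃ k ∈ τ, k ∉ ConeTriangulation.starCell v w := by
    by_contra! hcon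
    refine hpos.ne' (hforce _ hnn fun k hk => ?_)
    have hk' := hcon k hk
    simp only [ConeTriangulation.starCell, Finset.mem_insert, Finset.mem_erase] at hk'
    rcases hk' with rfl | hk'
    · exact absurd hk hv
    · exact T'.coord_ne _ hσ _ hi k hk'.2 (Ne.symm hk'.1)
  rw [map_mul, map_prod, Finset.prod_eq_zero (Finset.mem_compl.2 hk), mul_zero]
  rw [eval_Lpoly, ht k hkτ]

/-- Let `P = conv{x_1,…,x_m} ⊆ ℝ^d` be a full-dimensional compact convex
polytope (with the `x_k` its distinct vertices) with a triangulation `Σ` using only the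
vertices of `P`. Then the adjoint polynomial `Ad_P` has total degree at most `m − d − 1`
and vanishes at every point of the nonface subspace arrangement `NF(P)`, i.e. at every
`t` with `ℒ_k(t) = 0` for all `k ∈ τ`, for some nonface `τ` of `P`. -/
theorem stmt_3 (d m : ℕ) (x : Fin m → (Fin d → ℝ))
    (hfull : (interior (convexHull ℝ (Set.range x))).Nonempty)
    (hinj : Function.Injective x)
    (hext : Set.extremePoints ℝ (convexHull ℝ (Set.range x)) = Set.range x)
    (T : Triangulation d m x) :
    (adjoint d m x T).totalDegree ≤ m - d - 1 ∧
    ∀ τ : Finset (Fin m), ¬ IsFaceVtxSet d m x τ →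
      ∀ t : Fin d → ℝ, (∀ k ∈ τ, 1 - ∑ j, x k j * t j = 0) →
        MvPolynomial.eval t (adjoint d m x T) = 0 := by
  exact ⟨totalDegree_adjoint_le T, fun τ hτ t ht => eval_adjoint_eq_zero T hτ ht⟩
end

section
/- Let P = conv{x_1,…,x_m} ⊂ ℝ^d be a full-dimensional compact convex polytope with a triangulation Σ using only the vertices of P. Then there is a neighborhood U of 0 in ℝ^d such that for all t ∈ U the series ∑_{r ≥ 0} ((r+d)!/(d!·r!)) ∫_P ⟨x, t⟩^r λ(dx) converges absolutely and equals ∑_{σ∈Σ} V_d(σ) / ∏_{k∈σ} ℒ_k(t). In other words, the degree-r graded piece of the rational generating function ∑_{σ∈Σ} V_d(σ)/∏_{k∈σ} ℒ_k(t) is ((r+d)!/d!) · Φ_d^{r,0}(P)(t), where Φ_d^{r,0}(P)(t) = (1/r!) ∫_P ⟨x,t⟩^r λ(dx) is the polynomial obtained from the rank-r volume tensor Φ_d^{r,0}(P) = (1/r!)∫_P x^{⊗r} λ(dx) by substituting t_i for the basis vector e_i. -/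
open MeasureTheory Finset

/-- The Laplace transform of `s ^ n` on `(0, ∞)`, as a Lebesgue integral. -/
theorem lintegral_pow_mul_exp_neg_mul_Ioi (n : ℕ) {b : ℝ} (hb : 0 < b) :
    ∫⁻ s in Set.Ioi (0 : ℝ), ENNReal.ofReal (s ^ n * Real.exp (-(b * s))) =
      ENNReal.ofReal (n.factorial / b ^ (n + 1)) := by
  have h : ∫ s in Set.Ioi (0 : ℝ), s ^ n * Real.exp (-(b * s)) = n.factorial / b ^ (n + 1) := by
    have := Real.integral_rpow_mul_exp_neg_mul_Ioi (a := n + 1) (by positivity) hb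
    rw [Real.Gamma_nat_eq_factorial] at this
    simp only [add_sub_cancel_right, Real.rpow_natCast] at this
    rw [this, ← Nat.cast_succ, Real.rpow_natCast, one_div, inv_pow]
    field_simp
  have h_integrable : IntegrableOn (fun s : ℝ => s ^ n * Real.exp (-(b * s))) (Set.Ioi 0) := by
    by_contra hcon
    rw [integral_undef hcon] at h
    have : (0 : ℝ) < n.factorial / b ^ (n + 1) := by positivity
    exact this.ne h
  rw [← h, ofReal_integral_eq_lintegral_ofReal h_integrable]
  filter_upwards [ae_restrict_mem measurableSet_Ioi] with s hs
  have : (0 : ℝ) < s := hs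
  positivity

/-- The Laplace transform of the indicator function of the nonnegative orthant. -/
theorem lintegral_exp_neg_sum_Ici {ι : Type*} [Fintype ι] (b : ι → ℝ) (hb : ∀ i, 0 < b i) :
    ∫⁻ w in Set.Ici (0 : ι → ℝ), ENNReal.ofReal (Real.exp (-∑ i, b i * w i)) =
      ENNReal.ofReal (∏ i, 1 / b i) := by
  have hset : Set.Ici (0 : ι → ℝ) = Set.univ.pi fun _ => Set.Ici (0 : ℝ) := by
    ext w; simp [Pi.le_def]
  have hI (i : ι) : ∫ s in Set.Ici (0 : ℝ), Real.exp (-(b i * s)) = 1 / b i := by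
    rw [integral_Ici_eq_integral_Ioi]
    have := integral_exp_mul_Ioi (neg_lt_zero.2 (hb i)) 0
    simpa using this
  have h_integrable (i : ι) : Integrable (fun s => Real.exp (-(b i * s)))
      (volume.restrict (Set.Ici (0 : ℝ))) := by
    by_contra hcon
    have := hI i
    rw [integral_undef hcon] at this
    exact (one_div_pos.2 (hb i)).ne this
  have hexp (w : ι → ℝ) : Real.exp (-∑ i, b i * w i) = ∏ i, Real.exp (-(b i * w i)) := by
    rw [← Finset.sum_neg_distrib, Real.exp_sum]
  simp_rw [hset, hexp, volume_pi, Measure.restrict_pi_pi]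
  rw [← ofReal_integral_eq_lintegral_ofReal (Integrable.fintype_prod h_integrable)
    (Filter.Eventually.of_forall fun w => by positivity),
    integral_fintype_prod_eq_prod (fun i s => Real.exp (-(b i * s)))]
  simp_rw [hI]

section Simplex

variable {E : Type*} [NormedAddCommGroup E] [NormedSpace ℝ E] {ι : Type*} [Fintype ι]

/-- The linear map sending the `i`-th standard basis vector to the lift `(x i, 1)` of `x i`. -/
def homogenization (x : ι → E) : (ι → ℝ) →ₗ[ℝ] E × ℝ :=
  (Fintype.linearCombination ℝ x).prod (Fintype.linearCombination ℝ fun _ => (1 : ℝ))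

theorem homogenization_apply (x : ι → E) (w : ι → ℝ) :
    homogenization x w = (∑ i, w i • x i, ∑ i, w i) := by
  simp [homogenization, Fintype.linearCombination_apply]

theorem AffineIndependent.homogenization_injective {x : ι → E} (hx : AffineIndependent ℝ x) :
    Function.Injective (homogenization x) := by
  rw [injective_iff_map_eq_zero]
  intro w hw
  rw [homogenization_apply, Prod.mk_eq_zero] at hw
  ext i
  exact affineIndependent_iff.1 hx Finset.univ w hw.2 hw.1 i (Finset.mem_univ i)

variable [FiniteDimensional ℝ E]

/-- The vertices of a full-dimensional simplex, lifted to height one, as a basis. -/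
noncomputable def homogenizationEquiv (x : ι → E) (hx : AffineIndependent ℝ x)
    (hcard : Fintype.card ι = Module.finrank ℝ E + 1) : (ι → ℝ) ≃L[ℝ] E × ℝ :=
  (LinearEquiv.ofInjectiveOfFinrankEq (homogenization x) hx.homogenization_injective
    (by simp [hcard])).toContinuousLinearEquiv

theorem homogenizationEquiv_apply (x : ι → E) (hx : AffineIndependent ℝ x)
    (hcard : Fintype.card ι = Module.finrank ℝ E + 1) (w : ι → ℝ) :
    homogenizationEquiv x hx hcard w = (∑ i, w i • x i, ∑ i, w i) := by
  rw [← homogenization_apply]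
  exact DFunLike.congr_fun (LinearEquiv.coe_ofInjectiveOfFinrankEq (homogenization x)
    hx.homogenization_injective (by simp [hcard])) w

theorem mem_convexHull_range_iff_homogenizationEquiv_symm_nonneg (x : ι → E)
    (hx : AffineIndependent ℝ x) (hcard : Fintype.card ι = Module.finrank ℝ E + 1) (y : E) :
    y ∈ convexHull ℝ (Set.range x) ↔ 0 ≤ (homogenizationEquiv x hx hcard).symm (y, 1) := by
  classical
  set e := homogenizationEquiv x hx hcard
  constructor
  · intro hy
    have hconv : Convex ℝ {y : E | 0 ≤ e.symm (y, 1)} := by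
      intro y hy z hz a b ha hb hab
      have : ((a • y + b • z, 1) : E × ℝ) = a • (y, 1) + b • (z, 1) := by simp [hab]
      simp only [Set.mem_ofPred_eq] at hy hz ⊢
      rw [this, map_add, map_smul, map_smul]
      exact add_nonneg (smul_nonneg ha hy) (smul_nonneg hb hz)
    refine convexHull_min ?_ hconv hy
    rintro _ ⟨i, rfl⟩
    have : e (Pi.single i 1) = (x i, 1) := by
      simp [e, homogenizationEquiv_apply, Pi.single_apply]
    simp only [Set.mem_ofPred_eq]
    rw [← this, e.symm_apply_apply]
    exact Pi.single_nonneg.2 zero_le_one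
  · intro h
    have he := e.apply_symm_apply (y, 1)
    rw [homogenizationEquiv_apply, Prod.mk.injEq] at he
    exact mem_convexHull_of_exists_fintype _ x h he.2 (fun i => Set.mem_range_self i) he.1

variable [MeasurableSpace E] [BorelSpace E] (μ : Measure E) [μ.IsAddHaarMeasure]

theorem lintegral_comp_smul_mul_ofReal_pow {s : ℝ} (hs : 0 < s) (f : E → ENNReal) :
    ENNReal.ofReal (s ^ Module.finrank ℝ E) * ∫⁻ y, f (s • y) ∂μ = ∫⁻ u, f u ∂μ := by
  have h : ∫⁻ y, f (s • y) ∂μ = ∫⁻ u, f u ∂(μ.map (s • ·)) :=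
    ((Homeomorph.smulOfNeZero s hs.ne').measurableEmbedding.lintegral_map f).symm
  rw [h, Measure.map_addHaar_smul μ hs.ne', lintegral_smul_measure, smul_eq_mul, ← mul_assoc,
    ← ENNReal.ofReal_mul (by positivity), abs_of_pos (by positivity),
    mul_inv_cancel₀ (by positivity), ENNReal.ofReal_one, one_mul]

/-- Integrating `exp (ℓ u - s)` over the cone spanned by a simplex placed at height one, and
slicing the cone by height. -/
theorem lintegral_cone_exp (x : ι → E) (hx : AffineIndependent ℝ x)
    (hcard : Fintype.card ι = Module.finrank ℝ E + 1) (ℓ : E →L[ℝ] ℝ) (hℓ : ∀ i, ℓ (x i) < 1) :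
    ∫⁻ p in (homogenizationEquiv x hx hcard).symm ⁻¹' Set.Ici 0,
        ENNReal.ofReal (Real.exp (-(p.2 - ℓ p.1))) ∂(μ.prod volume) =
      ∫⁻ y in convexHull ℝ (Set.range x), ENNReal.ofReal
        ((Module.finrank ℝ E).factorial / (1 - ℓ y) ^ (Module.finrank ℝ E + 1)) ∂μ := by
  set e := homogenizationEquiv x hx hcard with he
  set n := Module.finrank ℝ E
  set S := convexHull ℝ (Set.range x)
  have hK : MeasurableSet (e.symm ⁻¹' Set.Ici 0) :=
    (isClosed_Ici.preimage e.symm.continuous).measurableSet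
  have hS : MeasurableSet S := ((Set.finite_range x).isClosed_convexHull ℝ).measurableSet
  have hSℓ : ∀ y ∈ S, ℓ y < 1 :=
    fun y hy => convexHull_min (Set.range_subset_iff.2 hℓ)
      (convex_halfSpace_lt ℓ.isLinear 1) hy
  set G : E × ℝ → ENNReal := fun p => ENNReal.ofReal (Real.exp (-(p.2 - ℓ p.1)))
  have hG : Measurable G := by fun_prop
  have hneg : ∀ s < 0, ∀ u, (u, s) ∉ e.symm ⁻¹' Set.Ici 0 := by
    intro s hs u hmem
    have h := e.apply_symm_apply (u, s)
    rw [he, homogenizationEquiv_apply, Prod.mk.injEq] at h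
    exact hs.not_ge (h.2 ▸ Finset.sum_nonneg fun i _ => hmem i)
  have hmem : ∀ s > 0, ∀ y, (s • y, s) ∈ e.symm ⁻¹' Set.Ici 0 ↔ y ∈ S := by
    intro s hs y
    have : ((s • y, s) : E × ℝ) = s • (y, 1) := by simp
    rw [mem_convexHull_range_iff_homogenizationEquiv_symm_nonneg x hx hcard, Set.mem_preimage,
      this, map_smul, Set.mem_Ici, smul_nonneg_iff_nonneg_of_pos_left hs]
  calc ∫⁻ p in e.symm ⁻¹' Set.Ici 0, G p ∂(μ.prod volume)
      = ∫⁻ s, ∫⁻ u, (e.symm ⁻¹' Set.Ici 0).indicator G (u, s) ∂μ := by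
        rw [← lintegral_indicator hK, lintegral_prod_symm' _ (hG.indicator hK)]
    _ = ∫⁻ s in Set.Ioi 0, ∫⁻ u, (e.symm ⁻¹' Set.Ici 0).indicator G (u, s) ∂μ := by
        rw [← lintegral_indicator measurableSet_Ioi]
        refine lintegral_congr_ae ?_
        filter_upwards [Measure.ae_ne volume (0 : ℝ)] with s hs
        rcases hs.lt_or_gt with h | h
        · simp [Set.indicator_of_notMem (hneg s h _), h.le]
        · simp [h]
    _ = ∫⁻ s in Set.Ioi 0, ∫⁻ y in S,
          ENNReal.ofReal (s ^ n * Real.exp (-((1 - ℓ y) * s))) ∂μ := by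
        refine setLIntegral_congr_fun measurableSet_Ioi fun s (hs : 0 < s) => ?_
        rw [← lintegral_comp_smul_mul_ofReal_pow μ hs, ← lintegral_const_mul' _ _ (by simp),
          ← lintegral_indicator hS]
        refine lintegral_congr fun y => ?_
        by_cases hy : y ∈ S
        · rw [Set.indicator_of_mem ((hmem s hs y).2 hy), Set.indicator_of_mem hy,
            ← ENNReal.ofReal_mul (by positivity)]
          simp only [map_smul, smul_eq_mul, n]
          ring_nf
        · rw [Set.indicator_of_notMem (mt (hmem s hs y).1 hy), Set.indicator_of_notMem hy,
            mul_zero]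
    _ = ∫⁻ y in S, (∫⁻ s in Set.Ioi 0,
          ENNReal.ofReal (s ^ n * Real.exp (-((1 - ℓ y) * s)))) ∂μ := by
        refine lintegral_lintegral_swap ?_
        unfold Function.uncurry
        fun_prop
    _ = _ := setLIntegral_congr_fun hS fun y hy =>
        lintegral_pow_mul_exp_neg_mul_Ioi n (sub_pos.2 (hSℓ y hy))

theorem exists_lintegral_simplex_eq_mul (x : ι → E) (hx : AffineIndependent ℝ x)
    (hcard : Fintype.card ι = Module.finrank ℝ E + 1) :
    ∃ c : ENNReal, ∀ ℓ : E →L[ℝ] ℝ, (∀ i, ℓ (x i) < 1) →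
      ∫⁻ y in convexHull ℝ (Set.range x), ENNReal.ofReal
        ((Module.finrank ℝ E).factorial / (1 - ℓ y) ^ (Module.finrank ℝ E + 1)) ∂μ =
      c * ENNReal.ofReal (∏ i, 1 / (1 - ℓ (x i))) := by
  set e := homogenizationEquiv x hx hcard with he
  refine ⟨(μ.prod volume).addHaarScalarFactor ((volume : Measure (ι → ℝ)).map e), fun ℓ hℓ => ?_⟩
  rw [← lintegral_cone_exp μ x hx hcard ℓ hℓ,
    ← lintegral_exp_neg_sum_Ici _ fun i => sub_pos.2 (hℓ i)]
  conv_lhs => rw [Measure.isAddLeftInvariant_eq_smul (μ.prod volume)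
    ((volume : Measure (ι → ℝ)).map e)]
  have hm : MeasurableEmbedding e := e.toHomeomorph.measurableEmbedding
  rw [Measure.restrict_smul, lintegral_smul_measure, hm.restrict_map, hm.lintegral_map]
  congr 1
  have hpre : e ⁻¹' (e.symm ⁻¹' Set.Ici 0) = Set.Ici 0 := by ext; simp
  rw [← he, hpre]
  refine lintegral_congr fun w => ?_
  rw [he, homogenizationEquiv_apply]
  congr 3
  simp only [map_sum, map_smul, smul_eq_mul, ← Finset.sum_sub_distrib]
  exact Finset.sum_congr rfl fun i _ => by ring

/-- The integral of `(1 - ℓ y)⁻¹ ^ (n + 1)` over an `n`-dimensional simplex. -/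
theorem integral_simplex_one_div_one_sub_pow (x : ι → E) (hx : AffineIndependent ℝ x)
    (hcard : Fintype.card ι = Module.finrank ℝ E + 1) (ℓ : E →L[ℝ] ℝ) (hℓ : ∀ i, ℓ (x i) < 1) :
    ∫ y in convexHull ℝ (Set.range x), 1 / (1 - ℓ y) ^ (Module.finrank ℝ E + 1) ∂μ =
      μ.real (convexHull ℝ (Set.range x)) / ∏ i, (1 - ℓ (x i)) := by
  set n := Module.finrank ℝ E
  set S := convexHull ℝ (Set.range x)
  obtain ⟨c, hc⟩ := exists_lintegral_simplex_eq_mul μ x hx hcard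
  have hS : MeasurableSet S := ((Set.finite_range x).isClosed_convexHull ℝ).measurableSet
  have hSℓ : ∀ y ∈ S, ℓ y < 1 :=
    fun y hy => convexHull_min (Set.range_subset_iff.2 hℓ)
      (convex_halfSpace_lt ℓ.isLinear 1) hy
  have h0 : c = n.factorial * μ S := by
    have := hc 0 (by simp)
    simpa using this.symm
  have hfac : (n.factorial : ℝ) ≠ 0 := by positivity
  have hprod : 0 ≤ ∏ i, 1 / (1 - ℓ (x i)) :=
    Finset.prod_nonneg fun i _ => one_div_nonneg.2 (sub_pos.2 (hℓ i)).le
  have key : ∫ y in S, n.factorial / (1 - ℓ y) ^ (n + 1) ∂μ =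
      n.factorial * (μ.real S / ∏ i, (1 - ℓ (x i))) := by
    rw [integral_eq_lintegral_of_nonneg_ae, hc ℓ hℓ, h0, ENNReal.toReal_mul, ENNReal.toReal_mul,
      ENNReal.toReal_ofReal hprod]
    · simp [Measure.real, div_eq_mul_inv, mul_assoc]
    · filter_upwards [ae_restrict_mem hS] with y hy
      have := sub_pos.2 (hSℓ y hy)
      positivity
    · exact Measurable.aestronglyMeasurable (by fun_prop)
  refine mul_left_cancel₀ hfac ?_
  rw [← key, ← integral_const_mul]
  simp only [mul_one_div]

end Simplex

/-- Convex sets with disjoint interiors overlap in a null set. -/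
theorem Convex.aedisjoint_of_interior_inter_eq_empty {E : Type*} [NormedAddCommGroup E]
    [NormedSpace ℝ E] [FiniteDimensional ℝ E] [MeasurableSpace E] [BorelSpace E] (μ : Measure E)
    [μ.IsAddHaarMeasure] {s t : Set E} (hs : Convex ℝ s) (ht : Convex ℝ t)
    (h : interior s ∩ interior t = ∅) : AEDisjoint μ s t := by
  refine measure_mono_null (t := frontier s ∪ frontier t) ?_
    (measure_union_null (hs.addHaar_frontier μ) (ht.addHaar_frontier μ))
  rintro y ⟨hys, hyt⟩
  by_contra hy
  simp only [Set.mem_union, not_or, frontier, Set.mem_sdiff, not_and, not_not] at hy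
  exact (h ▸ ⟨hy.1 (subset_closure hys), hy.2 (subset_closure hyt)⟩ : y ∈ (∅ : Set E))

/-- Termwise integration of the negative binomial series of a function bounded by `1 / 2`. -/
theorem hasSum_choose_mul_integral_pow {α : Type*} [MeasurableSpace α] {μ : Measure α}
    [IsFiniteMeasure μ] (n : ℕ) {f : α → ℝ} (hf : AEStronglyMeasurable f μ)
    (hbound : ∀ᵐ y ∂μ, ‖f y‖ ≤ 1 / 2) :
    HasSum (fun r : ℕ => ((r + n).choose n : ℝ) * ∫ y, f y ^ r ∂μ)
      (∫ y, 1 / (1 - f y) ^ (n + 1) ∂μ) := by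
  simp_rw [← integral_const_mul]
  refine hasSum_integral_of_dominated_convergence
    (fun r _ => ((r + n).choose n : ℝ) * (1 / 2) ^ r) (fun r => ?_) (fun r => ?_) ?_ ?_ ?_
  · exact (hf.pow r).const_mul _
  · filter_upwards [hbound] with y hy
    rw [norm_mul, norm_pow, Real.norm_natCast]
    gcongr
  · exact Filter.Eventually.of_forall fun _ =>
      (hasSum_choose_mul_geometric_of_norm_lt_one n (by norm_num)).summable
  · exact integrable_const _
  · filter_upwards [hbound] with y hy
    exact hasSum_choose_mul_geometric_of_norm_lt_one n (by linarith)

/-- Integration over a triangulated polytope, simplex by simplex. -/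
theorem Triangulation.setIntegral_eq_sum {d m : ℕ} {x : Fin m → (Fin d → ℝ)}
    (T : Triangulation d m x) {f : (Fin d → ℝ) → ℝ}
    (hf : IntegrableOn f (convexHull ℝ (Set.range x))) :
    ∫ y in convexHull ℝ (Set.range x), f y =
      ∑ σ ∈ T.simplices, ∫ y in convexHull ℝ (x '' ↑σ), f y := by
  have hU : convexHull ℝ (Set.range x) =
      ⋃ σ : T.simplices, convexHull ℝ (x '' (σ.1 : Set (Fin m))) := by
    rw [← T.covers, Set.iUnion_subtype]
  rw [hU] at hf ⊢
  rw [integral_iUnion_ae _ _ hf, tsum_fintype,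
    Finset.sum_coe_sort T.simplices fun σ => ∫ y in convexHull ℝ (x '' ↑σ), f y]
  · exact fun σ => (convex_convexHull ℝ _).nullMeasurableSet volume
  · exact fun σ τ hστ => (convex_convexHull ℝ _).aedisjoint_of_interior_inter_eq_empty volume
      (convex_convexHull ℝ _) (T.disj σ σ.2 τ τ.2 (Subtype.coe_injective.ne hστ))

/-- Let `P = conv{x_1,…,x_m} ⊆ ℝ^d` be a full-dimensional compact convex
polytope with a triangulation `Σ` using only the vertices of `P`. There is a neighborhood
`U` of `0` such that for all `t ∈ U` the series
`∑_{r≥0} ((r+d)!/(d!·r!)) ∫_P ⟨x,t⟩^r dλ(x)` converges absolutely and equals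
`∑_{σ∈Σ} V_d(σ) / ∏_{k∈σ} ℒ_k(t)`; its degree-`r` term is
`((r+d)!/d!) Φ_d^{r,0}(P)(t)` with `Φ_d^{r,0}(P)(t) = (1/r!) ∫_P ⟨x,t⟩^r dλ(x)`. -/
theorem stmt_6 (d m : ℕ) (x : Fin m → (Fin d → ℝ))
    (hfull : (interior (convexHull ℝ (Set.range x))).Nonempty)
    (T : Triangulation d m x) :
    ∃ U ∈ nhds (0 : Fin d → ℝ), ∀ t ∈ U,
      (Summable fun r : ℕ =>
        |(Nat.factorial (r + d) : ℝ) / (Nat.factorial d * Nat.factorial r) *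
          ∫ y in convexHull ℝ (Set.range x), (∑ j, y j * t j) ^ r ∂volume|) ∧
      (∑' r : ℕ,
          (Nat.factorial (r + d) : ℝ) / (Nat.factorial d * Nat.factorial r) *
            ∫ y in convexHull ℝ (Set.range x), (∑ j, y j * t j) ^ r ∂volume)
        = ∑ σ ∈ T.simplices,
            (volume (convexHull ℝ (x '' ↑σ))).toReal /
              ∏ k ∈ σ, (1 - ∑ j, x k j * t j) := by
  refine ⟨{t | ∀ k, ‖∑ j, x k j * t j‖ < 1 / 2}, ?_, fun t ht => ?_⟩
  · refine IsOpen.mem_nhds ?_ (by simp)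
    simp only [Set.ofPred_forall]
    exact isOpen_iInter_of_finite fun k => isOpen_lt (by fun_prop) continuous_const
  set ℓ : (Fin d → ℝ) →L[ℝ] ℝ :=
    LinearMap.toContinuousLinearMap (Fintype.linearCombination ℝ t)
  have hℓ (y : Fin d → ℝ) : ∑ j, y j * t j = ℓ y := by
    simp [ℓ, Fintype.linearCombination_apply]
  simp only [hℓ, Set.mem_ofPred_eq] at ht ⊢
  have hP : IsCompact (convexHull ℝ (Set.range x)) := (Set.finite_range x).isCompact_convexHull ℝ
  have hPℓ : ∀ y ∈ convexHull ℝ (Set.range x), ‖ℓ y‖ ≤ 1 / 2 := by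
    have hconv : Convex ℝ {y | ‖ℓ y‖ ≤ 1 / 2} := by
      simpa using ((convexOn_univ_norm (E := ℝ)).comp_linearMap ℓ.toLinearMap).convex_le (1 / 2)
    exact convexHull_min (Set.range_subset_iff.2 fun k => (ht k).le) hconv
  have : IsFiniteMeasure (volume.restrict (convexHull ℝ (Set.range x))) :=
    ⟨by simpa using hP.measure_lt_top⟩
  have hcoef (r : ℕ) : ((r + d).factorial : ℝ) / (d.factorial * r.factorial) =
      ((r + d).choose d : ℝ) := by
    rw [add_comm r d, Nat.cast_add_choose]
  simp only [hcoef]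
  have hsum := hasSum_choose_mul_integral_pow d (μ := volume.restrict (convexHull ℝ (Set.range x)))
    ℓ.continuous.aestronglyMeasurable
    (by filter_upwards [ae_restrict_mem hP.measurableSet] with y hy using hPℓ y hy)
  refine ⟨hsum.summable.abs, hsum.tsum_eq.trans ?_⟩
  rw [T.setIntegral_eq_sum]
  · refine Finset.sum_congr rfl fun σ hσ => ?_
    have := integral_simplex_one_div_one_sub_pow volume _ (T.indep σ hσ)
      (by simp [T.card_eq σ hσ]) ℓ fun k => by linarith [(abs_lt.1 (ht k.1)).2]
    have hrange : Set.range (fun k : {k // k ∈ σ} => x k.1) = x '' ↑σ := by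
      rw [Set.image_eq_range]; rfl
    rw [hrange, Module.finrank_fin_fun,
      Finset.prod_coe_sort σ fun k => 1 - ℓ (x k)] at this
    exact this
  · refine ContinuousOn.integrableOn_compact hP ?_
    refine continuousOn_const.div (by fun_prop) fun y hy => pow_ne_zero _ ?_
    linarith [(abs_le.1 (hPℓ y hy)).2]
end
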